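/- Let 𝒢 be an n-player potential game with potential Φ where each player has at most m strategies, and let ζ be the maximum over ordered pairs of profiles (x,y) of the minimum over Hamming paths γ from x to y of the maximum potential increase ζ(γ) along γ. Let P be the transition matrix of the logit dynamics for 𝒢 with inverse noise β ≥ 0, with eigenvalues 1 = λ_1 ≥ λ_2 ≥ ⋯ ≥ λ_{|S|}. Then 1 − λ_2 ≥ 1/(n·m^{2n+1}·e^{β·ζ}); consequently (since all eigenvalues of P are nonnegative) the relaxation time satisfies t_rel = 1/(1 − λ_2) ≤ n·m^{2n+1}·e^{β·ζ}. -/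

import Mathlib

noncomputable section

open Finset

variable {n : ℕ} {S : Fin n → Type*} [∀ i, Fintype (S i)] [∀ i, DecidableEq (S i)]
  [∀ i, Nonempty (S i)]

/-- Logit update probability `σ_i(z ∣ x)` with inverse noise `β` for the game with
utilities `u`. -/
def logitSigma (β : ℝ) (u : Fin n → (∀ i, S i) → ℝ) (i : Fin n) (z : S i)
    (x : ∀ i, S i) : ℝ :=
  Real.exp (β * u i (Function.update x i z)) /
    ∑ w : S i, Real.exp (β * u i (Function.update x i w))

/-- Transition matrix of the logit dynamics with inverse noise `β`:
`P x y = (1/n) · σ_i(y_i ∣ x)` if `x` and `y` differ exactly in coordinate `i`,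
`P x x = (1/n) · ∑ i, σ_i(x_i ∣ x)`, and `P x y = 0` otherwise. -/
def logitP (β : ℝ) (u : Fin n → (∀ i, S i) → ℝ) :
    Matrix (∀ i, S i) (∀ i, S i) ℝ := fun x y =>
  (1 / (n : ℝ)) *
    ∑ i, if y = Function.update x i (y i) then logitSigma β u i (y i) x else 0

/-- `Φ` is an (exact) potential for the game with utilities `u`. -/
def IsPotential (u : Fin n → (∀ i, S i) → ℝ) (Φ : (∀ i, S i) → ℝ) : Prop :=
  ∀ (i : Fin n) (a b : S i) (x : ∀ i, S i),
    u i (Function.update x i a) - u i (Function.update x i b) =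
      Φ (Function.update x i b) - Φ (Function.update x i a)

/-- The Gibbs measure `π(x) = exp(−β·Φ(x))/Z`. -/
def gibbs (β : ℝ) (Φ : (∀ i, S i) → ℝ) (x : ∀ i, S i) : ℝ :=
  Real.exp (-β * Φ x) / ∑ y : ∀ i, S i, Real.exp (-β * Φ y)

/-- Total variation distance `(1/2)·∑ z, |μ z − ν z|`. -/
def tvDist {α : Type*} [Fintype α] (μ ν : α → ℝ) : ℝ :=
  (1 / 2) * ∑ z, |μ z - ν z|

/-- Maximum global variation `ΔΦ = max Φ − min Φ`. -/
def maxVar (Φ : (∀ i, S i) → ℝ) : ℝ :=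
  sSup {d : ℝ | ∃ x y : ∀ i, S i, d = Φ x - Φ y}

/-- Two profiles are adjacent if they differ in exactly one coordinate. -/
def Adjacent (x y : ∀ i, S i) : Prop :=
  (Finset.univ.filter fun i => x i ≠ y i).card = 1

/-- Maximum local variation `δΦ`. -/
def localVar (Φ : (∀ i, S i) → ℝ) : ℝ :=
  sSup {d : ℝ | ∃ x y : ∀ i, S i, Adjacent x y ∧ d = Φ x - Φ y}

/-- A Hamming path from `x` to `y`: a list of profiles starting at `x`, ending at `y`,
in which consecutive profiles differ in exactly one coordinate. -/
def IsHammingPath (x y : ∀ i, S i) (γ : List (∀ i, S i)) : Prop :=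
  γ.head? = some x ∧ γ.getLast? = some y ∧ γ.Chain' Adjacent

/-- `ζ(γ) = max_{0 ≤ i ≤ k} (Φ(z^i) − Φ(z^0))`, the maximum potential increase along a path. -/
def zetaPath (Φ : (∀ i, S i) → ℝ) : List (∀ i, S i) → ℝ
  | [] => 0
  | z :: rest => ((z :: rest).map fun w => Φ w - Φ z).foldr max 0

/-- `ζ(x,y)`: minimum over Hamming paths from `x` to `y` of `ζ(γ)`. -/
def zetaXY (Φ : (∀ i, S i) → ℝ) (x y : ∀ i, S i) : ℝ :=
  sInf {d : ℝ | ∃ γ : List (∀ i, S i), IsHammingPath x y γ ∧ d = zetaPath Φ γ}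

/-- `ζ = max_{x,y} ζ(x,y)`. -/
def zeta (Φ : (∀ i, S i) → ℝ) : ℝ :=
  sSup {d : ℝ | ∃ x y : ∀ i, S i, d = zetaXY Φ x y}

section Comparison

variable {V : Type*} [Fintype V]

/-- Along a path whose edges all carry weight at least `c`, the squared increment of `f` is
controlled by the energy of `f` on the vertices of the path. -/
theorem SimpleGraph.Walk.IsPath.mul_sq_sub_le [DecidableEq V] {G : SimpleGraph V} (q : V → V → ℝ) (c : ℝ)
    (hc : 0 < c) (hq : ∀ a b, 0 ≤ q a b) (hG : ∀ a b, G.Adj a b → c ≤ q a b) (f : V → ℝ)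
    {x y : V} (p : G.Walk x y) (hp : p.IsPath) :
    c * (f x - f y) ^ 2 ≤
      p.length * ∑ a ∈ p.support.toFinset, ∑ b, q a b * (f a - f b) ^ 2 := by
  induction p with
  | nil => simp
  | @cons x z y h p ih =>
    rw [SimpleGraph.Walk.cons_isPath_iff] at hp
    have ih := ih hp.1
    rw [SimpleGraph.Walk.support_cons, List.toFinset_cons,
      Finset.sum_insert (by simpa using hp.2), SimpleGraph.Walk.length_cons]
    set T := ∑ a ∈ p.support.toFinset, ∑ b, q a b * (f a - f b) ^ 2
    have hQ : c * (f x - f z) ^ 2 ≤ ∑ b, q x b * (f x - f b) ^ 2 :=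
      (mul_le_mul_of_nonneg_right (hG x z h) (sq_nonneg _)).trans
        (Finset.single_le_sum (f := fun b => q x b * (f x - f b) ^ 2)
          (fun b _ => mul_nonneg (hq x b) (sq_nonneg _)) (Finset.mem_univ z))
    set Q := ∑ b, q x b * (f x - f b) ^ 2
    have hT : 0 ≤ T :=
      Finset.sum_nonneg fun a _ => Finset.sum_nonneg fun b _ => mul_nonneg (hq a b) (sq_nonneg _)
    have hsplit : f x - f y = (f x - f z) + (f z - f y) := by ring
    rw [hsplit]
    set s := f x - f z
    set t := f z - f y
    push_cast
    set L : ℝ := (p.length : ℝ) with hL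
    rcases (Nat.cast_nonneg p.length : (0 : ℝ) ≤ (p.length : ℝ)).eq_or_lt with h0 | h0
    · rw [← hL] at h0
      rw [← h0] at ih ⊢
      have ht : t = 0 := by
        have : t ^ 2 ≤ 0 := by nlinarith [sq_nonneg t]
        exact pow_eq_zero_iff two_ne_zero |>.1 (le_antisymm this (sq_nonneg t))
      rw [ht]
      linarith [show c * (s + 0) ^ 2 = c * s ^ 2 by ring]
    · rw [← hL] at h0
      have h1 : c * t ^ 2 / L ≤ T := by
        rw [div_le_iff₀ h0]; linarith
      have h2 : L * (c * s ^ 2) ≤ L * Q := mul_le_mul_of_nonneg_left hQ h0.le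
      have h3 : 2 * (c * s * t) ≤ L * (c * s ^ 2) + c * t ^ 2 / L := by
        have : L * (c * s ^ 2) + c * t ^ 2 / L - 2 * (c * s * t) = c * (L * s - t) ^ 2 / L := by
          field_simp
          ring
        have : 0 ≤ c * (L * s - t) ^ 2 / L := by positivity
        linarith
      nlinarith

theorem SimpleGraph.Reachable.mul_sq_sub_le {G : SimpleGraph V} (q : V → V → ℝ) (c : ℝ)
    (hc : 0 < c) (hq : ∀ a b, 0 ≤ q a b) (hG : ∀ a b, G.Adj a b → c ≤ q a b) (f : V → ℝ)
    {x y : V} (h : G.Reachable x y) :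
    c * (f x - f y) ^ 2 ≤ Fintype.card V * ∑ a, ∑ b, q a b * (f a - f b) ^ 2 := by
  classical
  obtain ⟨p, hp⟩ := h.exists_isPath
  have hnn : ∀ a, 0 ≤ ∑ b, q a b * (f a - f b) ^ 2 := fun a =>
    Finset.sum_nonneg fun b _ => mul_nonneg (hq a b) (sq_nonneg _)
  refine (hp.mul_sq_sub_le q c hc hq hG f p).trans ?_
  refine mul_le_mul (by exact_mod_cast hp.length_lt.le)
    (Finset.sum_le_sum_of_subset_of_nonneg (Finset.subset_univ _) fun a _ _ => hnn a)
    (Finset.sum_nonneg fun a _ => hnn a) (by positivity)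

/-- Spectral gap of a reversible stochastic matrix from a Poincaré-type inequality that holds
for each pair of states. -/
theorem one_le_mul_one_sub_of_reversible (w : V → ℝ) (P : Matrix V V ℝ) (K : ℝ)
    (hw : ∀ x, 0 < w x) (hrow : ∀ x, ∑ y, P x y = 1)
    (hrev : ∀ x y, w x * P x y = w y * P y x)
    (lam : ℝ) (v : V → ℝ) (hv : v ≠ 0) (hev : P.mulVec v = lam • v) (hlam : lam ≠ 1)
    (hpair : ∀ x y, w x * (v x - v y) ^ 2 ≤ K * ∑ a, ∑ b, w a * P a b * (v a - v b) ^ 2) :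
    1 ≤ Fintype.card V * K * (1 - lam) := by
  have hev' : ∀ x, ∑ y, P x y * v y = lam * v x := fun x => by
    simpa [Matrix.mulVec, dotProduct] using congrFun hev x
  have hcol : ∀ y, ∑ x, w x * P x y = w y := fun y => by
    simp_rw [hrev _ y, ← Finset.mul_sum, hrow, mul_one]
  have hmean : ∑ x, w x * v x = 0 := by
    have h1 : ∑ x, w x * (lam * v x) = ∑ x, w x * v x := by
      simp_rw [← hev', Finset.mul_sum]
      rw [Finset.sum_comm]
      refine Finset.sum_congr rfl fun y _ => ?_
      rw [← hcol y, Finset.sum_mul]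
      exact Finset.sum_congr rfl fun x _ => by ring
    have h2 : ∑ x, w x * (lam * v x) = lam * ∑ x, w x * v x := by
      rw [Finset.mul_sum]
      exact Finset.sum_congr rfl fun x _ => by ring
    have h3 : (lam - 1) * ∑ x, w x * v x = 0 := by linarith
    exact (mul_eq_zero.1 h3).resolve_left (sub_ne_zero.2 hlam)
  set N := ∑ x, w x * v x ^ 2 with hN
  have hNpos : 0 < N := by
    obtain ⟨x, hx⟩ := Function.ne_iff.1 hv
    have hx : v x ≠ 0 := hx
    exact Finset.sum_pos' (fun x _ => mul_nonneg (hw x).le (sq_nonneg _))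
      ⟨x, Finset.mem_univ x, mul_pos (hw x) (by positivity)⟩
  have hD : ∑ a, ∑ b, w a * P a b * (v a - v b) ^ 2 = 2 * (1 - lam) * N := by
    have e : ∀ a b, w a * P a b * (v a - v b) ^ 2 =
        w a * v a ^ 2 * P a b - 2 * (w a * v a * (P a b * v b)) + w a * P a b * v b ^ 2 :=
      fun a b => by ring
    simp_rw [e, Finset.sum_add_distrib, Finset.sum_sub_distrib, ← Finset.mul_sum, hrow, hev']
    rw [Finset.sum_comm (f := fun a b => w a * P a b * v b ^ 2)]
    simp_rw [← Finset.sum_mul, hcol]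
    have h2 : ∑ x, w x * v x * (lam * v x) = lam * N := by
      rw [hN, Finset.mul_sum]
      exact Finset.sum_congr rfl fun x _ => by ring
    rw [h2]
    simp only [mul_one, ← hN]
    ring
  have hvar : ∑ x, ∑ y, w y * (w x * (v x - v y) ^ 2) = 2 * (∑ x, w x) * N := by
    have e : ∀ x y, w y * (w x * (v x - v y) ^ 2) =
        w x * v x ^ 2 * w y - 2 * (w x * v x * (w y * v y)) + w x * (w y * v y ^ 2) :=
      fun x y => by ring
    simp_rw [e, Finset.sum_add_distrib, Finset.sum_sub_distrib, ← Finset.mul_sum,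
      ← Finset.sum_mul, hmean, ← hN]
    ring
  have hle : ∑ x, ∑ y, w y * (w x * (v x - v y) ^ 2) ≤
      Fintype.card V * ((∑ x, w x) * (K * (2 * (1 - lam) * N))) := by
    calc _ ≤ ∑ _x : V, ∑ y, w y * (K * (2 * (1 - lam) * N)) :=
          Finset.sum_le_sum fun x _ => Finset.sum_le_sum fun y _ =>
            mul_le_mul_of_nonneg_left (hD ▸ hpair x y) (hw y).le
      _ = _ := by simp [← Finset.sum_mul]
  obtain ⟨x, -⟩ := Function.ne_iff.1 hv
  have hW : 0 < ∑ x, w x := Finset.sum_pos (fun x _ => hw x) ⟨x, Finset.mem_univ x⟩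
  rw [hvar] at hle
  have hpos : 0 < 2 * (∑ x, w x) * N := by positivity
  refine le_of_mul_le_mul_left ?_ hpos
  linarith

end Comparison

omit [∀ i, Nonempty (S i)] in
theorem Function.sum_ite_eq_update (x : ∀ i, S i) (i : Fin n) (g : S i → ℝ) :
    ∑ y : ∀ j, S j, (if y = Function.update x i (y i) then g (y i) else 0) = ∑ z, g z := by
  rw [← Finset.sum_filter]
  refine Finset.sum_bij' (fun y _ => y i) (fun z _ => Function.update x i z) ?_ ?_ ?_ ?_ ?_
  · simp
  · simp
  · intro y hy
    exact (Finset.mem_filter.1 hy).2.symm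
  · simp
  · simp

omit [∀ i, DecidableEq (S i)] in
theorem logitSigma_nonneg (β : ℝ) (u : Fin n → (∀ i, S i) → ℝ) (i : Fin n) (z : S i)
    (x : ∀ i, S i) : 0 ≤ logitSigma β u i z x := by
  unfold logitSigma
  positivity

theorem logitP_nonneg (β : ℝ) (u : Fin n → (∀ i, S i) → ℝ) (x y : ∀ i, S i) :
    0 ≤ logitP β u x y := by
  unfold logitP
  refine mul_nonneg (by positivity) (Finset.sum_nonneg fun i _ => ?_)
  split_ifs
  · exact logitSigma_nonneg ..
  · exact le_rfl

theorem logitP_row_sum (hn : 1 ≤ n) (β : ℝ) (u : Fin n → (∀ i, S i) → ℝ) (x : ∀ i, S i) :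
    ∑ y, logitP β u x y = 1 := by
  unfold logitP
  rw [← Finset.mul_sum, Finset.sum_comm]
  have h : ∀ i, ∑ y : ∀ j, S j,
      (if y = Function.update x i (y i) then logitSigma β u i (y i) x else 0) = 1 := fun i => by
    rw [Function.sum_ite_eq_update x i (fun z => logitSigma β u i z x)]
    unfold logitSigma
    rw [← Finset.sum_div]
    exact div_self (Finset.sum_pos (fun w _ => Real.exp_pos _) Finset.univ_nonempty).ne'
  have hn' : (n : ℝ) ≠ 0 := by positivity
  simp [h, hn']

omit [∀ i, DecidableEq (S i)] [∀ i, Nonempty (S i)] in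
theorem logitSigma_eq {u : Fin n → (∀ i, S i) → ℝ} {Φ : (∀ i, S i) → ℝ}
    (hpot : IsPotential u Φ) (β : ℝ) (i : Fin n) (z : S i) (x : ∀ i, S i) :
    logitSigma β u i z x = Real.exp (-β * Φ (Function.update x i z)) /
      ∑ w : S i, Real.exp (-β * Φ (Function.update x i w)) := by
  have h : ∀ w, Real.exp (β * u i (Function.update x i w)) =
      Real.exp (β * (u i (Function.update x i z) + Φ (Function.update x i z))) *
        Real.exp (-β * Φ (Function.update x i w)) := fun w => by
    rw [← Real.exp_add]
    congr 1
    linear_combination β * hpot i w z x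
  unfold logitSigma
  simp_rw [h]
  rw [← Finset.mul_sum, mul_div_mul_left _ _ (Real.exp_pos _).ne']

omit [∀ i, Nonempty (S i)] in
theorem logitP_reversible {u : Fin n → (∀ i, S i) → ℝ} {Φ : (∀ i, S i) → ℝ}
    (hpot : IsPotential u Φ) (β : ℝ) (x y : ∀ i, S i) :
    Real.exp (-β * Φ x) * logitP β u x y = Real.exp (-β * Φ y) * logitP β u y x := by
  unfold logitP
  rw [mul_left_comm, mul_left_comm (Real.exp (-β * Φ y))]
  congr 1
  rw [Finset.mul_sum, Finset.mul_sum]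
  refine Finset.sum_congr rfl fun i _ => ?_
  have key : ∀ x y : ∀ i, S i, y = Function.update x i (y i) → x = Function.update y i (x i) :=
    fun x y h => by rw [h]; simp
  by_cases h : y = Function.update x i (y i)
  · have h' := key x y h
    rw [if_pos h, if_pos h', logitSigma_eq hpot, logitSigma_eq hpot, ← h, ← h']
    have : ∀ w, Function.update y i w = Function.update x i w := fun w => by rw [h]; simp
    simp_rw [this]
    ring
  · rw [if_neg h, if_neg fun h' => h (key y x h')]
    simp

/-- Transitions into a best response carry at least the stationary weight of the source, up to
the factor `n * m`. -/
theorem le_logitP_update_of_isMin (hn : 1 ≤ n) {m : ℕ} {u : Fin n → (∀ i, S i) → ℝ}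
    {Φ : (∀ i, S i) → ℝ} (hpot : IsPotential u Φ) {β : ℝ} (hβ : 0 ≤ β) (x : ∀ i, S i) (i : Fin n)
    (hm : Fintype.card (S i) ≤ m) (z : S i)
    (hz : ∀ w, Φ (Function.update x i z) ≤ Φ (Function.update x i w)) :
    1 / ((n : ℝ) * m) ≤ logitP β u x (Function.update x i z) := by
  have hσ : 1 / (m : ℝ) ≤ logitSigma β u i z x := by
    rw [logitSigma_eq hpot]
    have hcard : 0 < Fintype.card (S i) := Fintype.card_pos
    have hm0 : (0 : ℝ) < m := by exact_mod_cast hcard.trans_le hm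
    rw [div_le_div_iff₀ hm0 (Finset.sum_pos (fun w _ => Real.exp_pos _) Finset.univ_nonempty),
      one_mul, mul_comm]
    calc ∑ w, Real.exp (-β * Φ (Function.update x i w))
        ≤ ∑ _w : S i, Real.exp (-β * Φ (Function.update x i z)) :=
          Finset.sum_le_sum fun w _ => Real.exp_le_exp.2 (by nlinarith [hz w])
      _ = Fintype.card (S i) * Real.exp (-β * Φ (Function.update x i z)) := by simp
      _ ≤ m * Real.exp (-β * Φ (Function.update x i z)) := by gcongr
  unfold logitP
  rw [show (1 : ℝ) / (n * m) = 1 / n * (1 / m) by rw [one_div_mul_one_div]]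
  refine mul_le_mul_of_nonneg_left (hσ.trans ?_) (by positivity)
  have h := Finset.single_le_sum (s := Finset.univ)
    (f := fun j => if Function.update x i z = Function.update x j (Function.update x i z j)
      then logitSigma β u j (Function.update x i z j) x else 0)
    (fun j _ => ite_nonneg (logitSigma_nonneg ..) le_rfl) (Finset.mem_univ i)
  rw [Function.update_self, if_pos rfl] at h
  exact h

omit [∀ i, Fintype (S i)] [∀ i, Nonempty (S i)] in
theorem Adjacent.exists_eq_update {x y : ∀ i, S i} (h : Adjacent x y) :
    ∃ i, y = Function.update x i (y i) := by
  obtain ⟨i, hi⟩ := Finset.card_eq_one.1 h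
  refine ⟨i, funext fun j => ?_⟩
  by_cases hj : j = i
  · subst hj; simp
  · rw [Function.update_of_ne hj]
    by_contra hne
    have : j ∈ Finset.univ.filter fun i => x i ≠ y i := by simpa using Ne.symm hne
    rw [hi] at this
    exact hj (Finset.mem_singleton.1 this)

omit [∀ i, Fintype (S i)] [∀ i, Nonempty (S i)] in
theorem reflTransGen_adjacent (x y : ∀ i, S i) : Relation.ReflTransGen Adjacent x y := by
  induction hk : (Finset.univ.filter fun i => x i ≠ y i).card generalizing x with
  | zero =>
    have : x = y := by
      funext i
      by_contra hne
      have hi : i ∈ Finset.univ.filter fun i => x i ≠ y i := by simpa using hne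
      rw [Finset.card_eq_zero.1 hk] at hi
      simp at hi
    rw [this]
  | succ k ih =>
    obtain ⟨i, hi⟩ := Finset.card_pos.1 (k.succ_pos.trans_eq hk.symm)
    have hi' : x i ≠ y i := by simpa using hi
    refine Relation.ReflTransGen.head (b := Function.update x i (y i)) ?_ (ih _ ?_)
    · refine Finset.card_eq_one.2 ⟨i, ?_⟩
      ext j
      by_cases hj : j = i
      · subst hj; simp [hi']
      · simp [hj]
    · have : (Finset.univ.filter fun j => Function.update x i (y i) j ≠ y j) =
          (Finset.univ.filter fun j => x j ≠ y j).erase i := by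
        ext j
        by_cases hj : j = i
        · subst hj; simp
        · simp [hj]
      rw [this, Finset.card_erase_of_mem hi, hk]
      rfl

omit [∀ i, Fintype (S i)] [∀ i, Nonempty (S i)] in
theorem exists_isHammingPath (x y : ∀ i, S i) : ∃ γ, IsHammingPath x y γ := by
  obtain ⟨l, hl, hy⟩ := List.exists_isChain_cons_of_relationReflTransGen (reflTransGen_adjacent x y)
  refine ⟨x :: l, rfl, ?_, hl⟩
  rw [List.getLast?_eq_getLast_of_ne_nil (List.cons_ne_nil _ _), hy]

theorem List.foldr_max_zero_mem (l : List ℝ) : l.foldr max 0 = 0 ∨ l.foldr max 0 ∈ l := by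
  induction l with
  | nil => simp
  | cons a l ih =>
    rw [List.foldr_cons]
    rcases max_choice a (l.foldr max 0) with h | h <;> rw [h]
    · simp
    · exact ih.imp id (List.mem_cons_of_mem _)

theorem List.le_foldr_max_zero {l : List ℝ} {a : ℝ} (h : a ∈ l) : a ≤ l.foldr max 0 := by
  induction l with
  | nil => simp at h
  | cons b l ih =>
    rw [List.foldr_cons]
    rcases List.mem_cons.1 h with rfl | h
    · exact le_max_left _ _
    · exact (ih h).trans (le_max_right _ _)

omit [∀ i, Fintype (S i)] [∀ i, DecidableEq (S i)] in
theorem zetaPath_mem_range (Φ : (∀ i, S i) → ℝ) (γ : List (∀ i, S i)) :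
    zetaPath Φ γ ∈ Set.range fun p : (∀ i, S i) × (∀ i, S i) => Φ p.1 - Φ p.2 := by
  have h0 : (0 : ℝ) ∈ Set.range fun p : (∀ i, S i) × (∀ i, S i) => Φ p.1 - Φ p.2 :=
    ⟨(fun _ => Classical.arbitrary _, fun _ => Classical.arbitrary _), sub_self _⟩
  cases γ with
  | nil => exact h0
  | cons z γ =>
    change ((z :: γ).map fun w => Φ w - Φ z).foldr max 0 ∈ _
    rcases List.foldr_max_zero_mem ((z :: γ).map fun w => Φ w - Φ z) with h | h
    · rw [h]; exact h0
    · obtain ⟨w, -, hw⟩ := List.mem_map.1 h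
      exact ⟨(w, z), hw⟩

/-- The infimum defining `ζ(x,y)` is attained. -/
theorem exists_zetaXY_eq (Φ : (∀ i, S i) → ℝ) (x y : ∀ i, S i) :
    ∃ γ, IsHammingPath x y γ ∧ zetaXY Φ x y = zetaPath Φ γ := by
  obtain ⟨γ, hγ⟩ := exists_isHammingPath x y
  refine Set.Nonempty.csInf_mem
    (s := {d : ℝ | ∃ γ : List (∀ i, S i), IsHammingPath x y γ ∧ d = zetaPath Φ γ})
    ⟨_, γ, hγ, rfl⟩ ((Set.finite_range
      fun p : (∀ i, S i) × (∀ i, S i) => Φ p.1 - Φ p.2).subset ?_)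
  rintro _ ⟨γ, -, rfl⟩
  exact zetaPath_mem_range Φ γ

omit [∀ i, Nonempty (S i)] in
theorem zetaXY_le_zeta (Φ : (∀ i, S i) → ℝ) (x y : ∀ i, S i) : zetaXY Φ x y ≤ zeta Φ := by
  refine le_csSup (Set.Finite.bddAbove ?_) ⟨x, y, rfl⟩
  refine (Set.finite_range fun p : (∀ i, S i) × (∀ i, S i) => zetaXY Φ p.1 p.2).subset ?_
  rintro _ ⟨x, y, rfl⟩
  exact ⟨(x, y), rfl⟩

theorem exists_isHammingPath_le_zeta (Φ : (∀ i, S i) → ℝ) (x y : ∀ i, S i) :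
    ∃ γ, IsHammingPath x y γ ∧ ∀ w ∈ γ, Φ w ≤ Φ x + zeta Φ := by
  obtain ⟨γ, hγ, h⟩ := exists_zetaXY_eq Φ x y
  refine ⟨γ, hγ, fun w hw => ?_⟩
  have hz := zetaXY_le_zeta Φ x y
  cases γ with
  | nil => simp at hw
  | cons z γ =>
    obtain rfl : z = x := by simpa using hγ.1
    have : Φ w - Φ z ≤ zetaPath Φ (z :: γ) := by
      unfold zetaPath
      exact List.le_foldr_max_zero (List.mem_map.2 ⟨w, hw, rfl⟩)
    linarith

/-- Pairs of distinct profiles whose stationary flow under the logit dynamics (with the Gibbs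
measure unnormalised) is at least `c`. -/
def flowGraph {u : Fin n → (∀ i, S i) → ℝ} {Φ : (∀ i, S i) → ℝ} (hpot : IsPotential u Φ)
    (β c : ℝ) : SimpleGraph (∀ i, S i) where
  Adj a b := a ≠ b ∧ c ≤ Real.exp (-β * Φ a) * logitP β u a b
  symm := ⟨fun a b h => ⟨h.1.symm, by rw [logitP_reversible hpot]; exact h.2⟩⟩
  loopless := ⟨fun _ h => h.1 rfl⟩

theorem flowGraph_reachable_of_adjacent (hn : 1 ≤ n) {m : ℕ} (hm : ∀ i, Fintype.card (S i) ≤ m)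
    {u : Fin n → (∀ i, S i) → ℝ} {Φ : (∀ i, S i) → ℝ} (hpot : IsPotential u Φ) {β : ℝ}
    (hβ : 0 ≤ β) {H : ℝ} {a b : ∀ i, S i} (ha : Φ a ≤ H) (hb : Φ b ≤ H) (hab : Adjacent a b) :
    (flowGraph hpot β (Real.exp (-β * H) * (1 / ((n : ℝ) * m)))).Reachable a b := by
  obtain ⟨i, hi⟩ := hab.exists_eq_update
  obtain ⟨z, hz⟩ := Finite.exists_min fun w => Φ (Function.update a i w)
  have step : ∀ x : ∀ i, S i, Φ x ≤ H → (∀ w, Function.update x i w = Function.update a i w) →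
      (flowGraph hpot β (Real.exp (-β * H) * (1 / ((n : ℝ) * m)))).Reachable x
        (Function.update a i z) := by
    intro x hx hxa
    by_cases hxz : x = Function.update a i z
    · rw [← hxz]
    · refine SimpleGraph.Adj.reachable ⟨hxz, ?_⟩
      refine mul_le_mul (Real.exp_le_exp.2 (by nlinarith)) ?_ (by positivity) (by positivity)
      rw [← hxa]
      exact le_logitP_update_of_isMin hn hpot hβ x i (hm i) z fun w => by
        rw [hxa, hxa]; exact hz w
  exact (step a ha fun _ => rfl).trans (step b hb fun w => by rw [hi]; simp).symm

theorem flowGraph_reachable_of_isHammingPath (hn : 1 ≤ n) {m : ℕ}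
    (hm : ∀ i, Fintype.card (S i) ≤ m) {u : Fin n → (∀ i, S i) → ℝ} {Φ : (∀ i, S i) → ℝ}
    (hpot : IsPotential u Φ) {β : ℝ} (hβ : 0 ≤ β) {H : ℝ} (γ : List (∀ i, S i))
    {x y : ∀ i, S i} (hγ : IsHammingPath x y γ) (hH : ∀ w ∈ γ, Φ w ≤ H) :
    (flowGraph hpot β (Real.exp (-β * H) * (1 / ((n : ℝ) * m)))).Reachable x y := by
  obtain ⟨hx, hy, hc⟩ := hγ
  have hc : γ.IsChain Adjacent := hc
  induction γ generalizing x with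
  | nil => simp at hx
  | cons z γ ih =>
    obtain rfl : z = x := by simpa using hx
    cases γ with
    | nil =>
      obtain rfl : z = y := by simpa using hy
      exact SimpleGraph.Reachable.refl _
    | cons t γ =>
      rw [List.isChain_cons_cons] at hc
      refine (flowGraph_reachable_of_adjacent hn hm hpot hβ (hH z (by simp)) (hH t (by simp))
        hc.1).trans (ih (fun w hw => hH w (List.mem_cons_of_mem _ hw)) rfl ?_ hc.2 hc.2)
      rwa [List.getLast?_cons_cons] at hy

/-- For an `n`-player potential game where each player has at most `m`
strategies, every eigenvalue `λ ≠ 1` of the logit dynamics transition matrix satisfies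
`λ ≤ 1 − 1/(n·m^{2n+1}·e^{β·ζ})`, i.e. `1 − λ₂ ≥ 1/(n·m^{2n+1}·e^{β·ζ})`, so the
relaxation time is at most `n·m^{2n+1}·e^{β·ζ}`. -/
theorem logit_relaxation_zeta_bound
    (hn : 1 ≤ n) (m : ℕ) (hm : ∀ i, Fintype.card (S i) ≤ m)
    (u : Fin n → (∀ i, S i) → ℝ) (Φ : (∀ i, S i) → ℝ)
    (hpot : IsPotential u Φ) (β : ℝ) (hβ : 0 ≤ β) :
    ∀ (lam : ℝ) (v : (∀ i, S i) → ℝ), v ≠ 0 →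
      (logitP β u).mulVec v = lam • v → lam ≠ 1 →
      lam ≤ 1 - 1 / ((n : ℝ) * (m : ℝ) ^ (2 * n + 1) * Real.exp (β * zeta Φ)) := by
  intro lam v hv hev hlam
  have hm1 : 1 ≤ m := (Fintype.card_pos (α := S ⟨0, hn⟩)).trans_le (hm _)
  have hn0 : (0 : ℝ) < n := by exact_mod_cast hn
  have hm0 : (0 : ℝ) < m := by exact_mod_cast hm1
  have hcard : (Fintype.card (∀ i, S i) : ℝ) ≤ (m : ℝ) ^ n := by
    have h := Finset.prod_le_pow_card Finset.univ (fun i => Fintype.card (S i)) m fun i _ => hm i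
    rw [Finset.card_univ, Fintype.card_fin, ← Fintype.card_pi] at h
    exact_mod_cast h
  set N : ℝ := (Fintype.card (∀ i, S i) : ℝ)
  have hN : 0 ≤ N := Nat.cast_nonneg _
  set E := Real.exp (β * zeta Φ) with hE
  have hE0 : 0 < E := Real.exp_pos _
  have hgap := one_le_mul_one_sub_of_reversible (fun x => Real.exp (-β * Φ x)) (logitP β u)
    (N * (n * m * E)) (fun x => Real.exp_pos _) (logitP_row_sum hn β u)
    (logitP_reversible hpot β) lam v hv hev hlam fun x y => by
      obtain ⟨γ, hγ, hH⟩ := exists_isHammingPath_le_zeta Φ x y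
      have hreach := flowGraph_reachable_of_isHammingPath hn hm hpot hβ γ hγ hH
      have h := hreach.mul_sq_sub_le (G := flowGraph hpot β _)
        (fun a b => Real.exp (-β * Φ a) * logitP β u a b)
        (Real.exp (-β * (Φ x + zeta Φ)) * (1 / ((n : ℝ) * m))) (by positivity)
        (fun a b => mul_nonneg (Real.exp_pos _).le (logitP_nonneg β u a b))
        (fun a b hab => hab.2) v
      have hw : Real.exp (-β * Φ x) =
          n * m * E * (Real.exp (-β * (Φ x + zeta Φ)) * (1 / ((n : ℝ) * m))) := by
        have : Real.exp (-β * Φ x) = E * Real.exp (-β * (Φ x + zeta Φ)) := by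
          rw [hE, ← Real.exp_add]
          congr 1
          ring
        rw [this]
        field_simp
      rw [hw, mul_assoc, mul_comm N, mul_assoc (n * m * E) N]
      exact mul_le_mul_of_nonneg_left h (by positivity)
  have hpos : 0 < 1 - lam := by
    by_contra hle
    have : N * (N * (n * m * E)) * (1 - lam) ≤ 0 :=
      mul_nonpos_of_nonneg_of_nonpos (by positivity) (not_lt.1 hle)
    linarith
  have hbound : 1 ≤ (1 - lam) * (n * (m : ℝ) ^ (2 * n + 1) * E) := by
    calc 1 ≤ N * (N * (n * m * E)) * (1 - lam) := hgap
      _ ≤ (m : ℝ) ^ n * ((m : ℝ) ^ n * (n * m * E)) * (1 - lam) := by gcongr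
      _ = (1 - lam) * (n * (m : ℝ) ^ (2 * n + 1) * E) := by ring
  have : 1 / ((n : ℝ) * (m : ℝ) ^ (2 * n + 1) * E) ≤ 1 - lam := by
    rwa [div_le_iff₀ (by positivity)]
  linarith
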